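/- Let A be a fanning frame with coefficient curves P_1,…,P_k, fundamental endomorphism F, fundamental projection P(t) := (I − D(t))/2 where D(t) = (1/k)(2F'(t) − (k−2)·I), and horizontal derivative H(t) := A^{(k−1)}(t) + Σ_{i=1}^{k−1} C(k−1,i) A^{(k−1−i)}(t) P_i(t). Then for every t ∈ ℝ: H(t) = (I − P(t))A^{(k−1)}(t) = P'(t)A^{(k−2)}(t) = A^{(k−1)}(t) − (1/k)F(t)A^{(k)}(t) = −(1/k)F''(t)A^{(k−2)}(t). -/

import Mathlib

open Matrix

noncomputable def mderiv {M N : ℕ} (A : ℝ → Matrix (Fin M) (Fin N) ℝ) :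
    ℝ → Matrix (Fin M) (Fin N) ℝ :=
  fun t => Matrix.of fun i j => deriv (fun s => A s i j) t

noncomputable def dmat {M N : ℕ} (i : ℕ) (A : ℝ → Matrix (Fin M) (Fin N) ℝ) :
    ℝ → Matrix (Fin M) (Fin N) ℝ :=
  mderiv^[i] A

def MatSmooth {M N : ℕ} (A : ℝ → Matrix (Fin M) (Fin N) ℝ) : Prop :=
  ∀ i j, ContDiff ℝ (⊤ : ℕ∞) fun t => A t i j

def juxt (k n : ℕ) (B : Fin k → Matrix (Fin (k * n)) (Fin n) ℝ) :
    Matrix (Fin (k * n)) (Fin (k * n)) ℝ :=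
  Matrix.of fun r c => B (finProdFinEquiv.symm c).1 r (finProdFinEquiv.symm c).2

noncomputable def frameMat (k n : ℕ) (A : ℝ → Matrix (Fin (k * n)) (Fin n) ℝ) (t : ℝ) :
    Matrix (Fin (k * n)) (Fin (k * n)) ℝ :=
  juxt k n fun i => dmat (i : ℕ) A t

def IsFanning (k n : ℕ) (A : ℝ → Matrix (Fin (k * n)) (Fin n) ℝ) : Prop :=
  MatSmooth A ∧ ∀ t, IsUnit (frameMat k n A t)

def IsCoeffs (k n : ℕ) (A : ℝ → Matrix (Fin (k * n)) (Fin n) ℝ)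
    (P : ℕ → ℝ → Matrix (Fin n) (Fin n) ℝ) : Prop :=
  (∀ i ∈ Finset.Icc 1 k, MatSmooth (P i)) ∧
  ∀ t, dmat k A t + ∑ i ∈ Finset.Icc 1 k, (k.choose i : ℝ) • (dmat (k - i) A t * P i t) = 0

noncomputable def Nmat (k n : ℕ) : Matrix (Fin (k * n)) (Fin (k * n)) ℝ :=
  Matrix.of fun r c =>
    if ((finProdFinEquiv.symm c).1 : ℕ) = ((finProdFinEquiv.symm r).1 : ℕ) + 1 ∧
        (finProdFinEquiv.symm c).2 = (finProdFinEquiv.symm r).2 then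
      (((finProdFinEquiv.symm r).1 : ℕ) + 1 : ℝ)
    else 0

noncomputable def fundEnd (k n : ℕ) (A : ℝ → Matrix (Fin (k * n)) (Fin n) ℝ) (t : ℝ) :
    Matrix (Fin (k * n)) (Fin (k * n)) ℝ :=
  frameMat k n A t * Nmat k n * (frameMat k n A t)⁻¹

noncomputable def fundRefl (k n : ℕ) (A : ℝ → Matrix (Fin (k * n)) (Fin n) ℝ) (t : ℝ) :
    Matrix (Fin (k * n)) (Fin (k * n)) ℝ :=
  (k : ℝ)⁻¹ • ((2 : ℝ) • mderiv (fundEnd k n A) t - ((k : ℝ) - 2) • (1 : Matrix (Fin (k * n)) (Fin (k * n)) ℝ))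

noncomputable def fundProj (k n : ℕ) (A : ℝ → Matrix (Fin (k * n)) (Fin n) ℝ) (t : ℝ) :
    Matrix (Fin (k * n)) (Fin (k * n)) ℝ :=
  (2 : ℝ)⁻¹ • ((1 : Matrix (Fin (k * n)) (Fin (k * n)) ℝ) - fundRefl k n A t)

noncomputable def horDer (k n : ℕ) (A : ℝ → Matrix (Fin (k * n)) (Fin n) ℝ)
    (P : ℕ → ℝ → Matrix (Fin n) (Fin n) ℝ) (t : ℝ) : Matrix (Fin (k * n)) (Fin n) ℝ :=
  dmat (k - 1) A t + ∑ i ∈ Finset.Icc 1 (k - 1), ((k - 1).choose i : ℝ) • (dmat (k - 1 - i) A t * P i t)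

noncomputable def jacobiEnd (k n : ℕ) (A : ℝ → Matrix (Fin (k * n)) (Fin n) ℝ) (t : ℝ) :
    Matrix (Fin (k * n)) (Fin (k * n)) ℝ :=
  (((k : ℝ)) ^ 2)⁻¹ • (mderiv (mderiv (fundEnd k n A)) t * mderiv (mderiv (fundEnd k n A)) t)

lemma MatSmooth.mderiv {M N : ℕ} {A : ℝ → Matrix (Fin M) (Fin N) ℝ} (hA : MatSmooth A) :
    MatSmooth (mderiv A) := fun i j =>
  (contDiff_infty_iff_deriv.mp (hA i j)).2

lemma MatSmooth.dmat {M N : ℕ} {A : ℝ → Matrix (Fin M) (Fin N) ℝ} (hA : MatSmooth A) (i : ℕ) :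
    MatSmooth (dmat i A) := by
  induction i with
  | zero => exact hA
  | succ i ih =>
    rw [_root_.dmat, Function.iterate_succ_apply']
    exact ih.mderiv

lemma MatSmooth.differentiableAt {M N : ℕ} {A : ℝ → Matrix (Fin M) (Fin N) ℝ}
    (hA : MatSmooth A) (i : Fin M) (j : Fin N) (t : ℝ) :
    DifferentiableAt ℝ (fun s => A s i j) t :=
  (hA i j).contDiffAt.differentiableAt (by simp)

lemma matSmooth_const {M N : ℕ} (C : Matrix (Fin M) (Fin N) ℝ) : MatSmooth fun _ => C :=
  fun _ _ => contDiff_const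

lemma MatSmooth.mul {L M N : ℕ} {A : ℝ → Matrix (Fin L) (Fin M) ℝ}
    {B : ℝ → Matrix (Fin M) (Fin N) ℝ} (hA : MatSmooth A) (hB : MatSmooth B) :
    MatSmooth fun t => A t * B t := by
  intro i j
  simp only [Matrix.mul_apply]
  exact ContDiff.sum fun l _ => (hA i l).mul (hB l j)

lemma MatSmooth.det {M : ℕ} {A : ℝ → Matrix (Fin M) (Fin M) ℝ} (hA : MatSmooth A) :
    ContDiff ℝ (⊤ : ℕ∞) fun t => (A t).det := by
  simp only [Matrix.det_apply']
  exact ContDiff.sum fun σ _ => contDiff_const.mul (contDiff_prod fun i _ => hA _ _)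

lemma MatSmooth.inv {M : ℕ} {A : ℝ → Matrix (Fin M) (Fin M) ℝ} (hA : MatSmooth A)
    (hu : ∀ t, IsUnit (A t)) : MatSmooth fun t => (A t)⁻¹ := by
  intro i j
  simp only [Matrix.inv_def, Ring.inverse_eq_inv', Matrix.smul_apply, smul_eq_mul,
    Matrix.adjugate_apply]
  refine (hA.det.inv fun t => ((Matrix.isUnit_iff_isUnit_det _).mp (hu t)).ne_zero).mul
    (MatSmooth.det (A := fun t => (A t).updateRow j (Pi.single i 1)) fun a b => ?_)
  by_cases h : a = j
  · subst h
    simpa using contDiff_const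
  · simpa [Matrix.updateRow_ne h] using hA a b

lemma mderiv_mul {L M N : ℕ} {A : ℝ → Matrix (Fin L) (Fin M) ℝ}
    {B : ℝ → Matrix (Fin M) (Fin N) ℝ} (hA : MatSmooth A) (hB : MatSmooth B) (t : ℝ) :
    mderiv (fun s => A s * B s) t = mderiv A t * B t + A t * mderiv B t := by
  ext i j
  simp only [mderiv, Matrix.of_apply, Matrix.mul_apply, Matrix.add_apply]
  rw [deriv_fun_sum fun l _ => (hA.differentiableAt i l t).fun_mul (hB.differentiableAt l j t),
    ← Finset.sum_add_distrib]
  exact Finset.sum_congr rfl fun l _ =>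
    deriv_fun_mul (hA.differentiableAt i l t) (hB.differentiableAt l j t)

lemma mderiv_const_smul {M N : ℕ} (c : ℝ) (A : ℝ → Matrix (Fin M) (Fin N) ℝ) (t : ℝ) :
    mderiv (fun s => c • A s) t = c • mderiv A t := by
  ext i j
  simp [mderiv]

lemma mderiv_const_sub {M N : ℕ} (C : Matrix (Fin M) (Fin N) ℝ)
    (A : ℝ → Matrix (Fin M) (Fin N) ℝ) (t : ℝ) :
    mderiv (fun s => C - A s) t = -mderiv A t := by
  ext i j
  simp [mderiv]

lemma mderiv_dmat {M N : ℕ} (i : ℕ) (A : ℝ → Matrix (Fin M) (Fin N) ℝ) (t : ℝ) :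
    mderiv (dmat i A) t = dmat (i + 1) A t := by
  rw [dmat, dmat, Function.iterate_succ_apply']

section Fanning

variable {k n : ℕ} {A : ℝ → Matrix (Fin (k * n)) (Fin n) ℝ}

lemma matSmooth_frameMat (hA : MatSmooth A) : MatSmooth (frameMat k n A) := fun i _ =>
  hA.dmat _ i _

lemma IsFanning.matSmooth_fundEnd (hA : IsFanning k n A) : MatSmooth (fundEnd k n A) :=
  ((matSmooth_frameMat hA.1).mul (matSmooth_const _)).mul ((matSmooth_frameMat hA.1).inv hA.2)

lemma frameMat_apply_finProdFinEquiv (A : ℝ → Matrix (Fin (k * n)) (Fin n) ℝ) (t : ℝ)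
    (r : Fin (k * n)) (i : Fin k) (c : Fin n) :
    frameMat k n A t r (finProdFinEquiv (i, c)) = dmat (i : ℕ) A t r c := by
  simp only [frameMat, juxt, Matrix.of_apply, Equiv.symm_apply_apply]

lemma IsFanning.fundEnd_mul_dmat (hA : IsFanning k n A) {i : ℕ} (hi : i < k) (t : ℝ) :
    fundEnd k n A t * dmat i A t = (i : ℝ) • dmat (i - 1) A t := by
  have h : fundEnd k n A t * frameMat k n A t = frameMat k n A t * Nmat k n := by
    rw [fundEnd, Matrix.mul_assoc,
      Matrix.nonsing_inv_mul _ ((Matrix.isUnit_iff_isUnit_det _).mp (hA.2 t)), Matrix.mul_one]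
  ext r c
  have hl : (fundEnd k n A t * dmat i A t) r c =
      (fundEnd k n A t * frameMat k n A t) r (finProdFinEquiv (⟨i, hi⟩, c)) := by
    simp only [Matrix.mul_apply, frameMat_apply_finProdFinEquiv]
  rw [hl, h, Matrix.mul_apply, ← finProdFinEquiv.sum_comp, Fintype.sum_prod_type]
  simp only [frameMat_apply_finProdFinEquiv, Nmat, Matrix.of_apply, Equiv.symm_apply_apply,
    Matrix.smul_apply, smul_eq_mul]
  cases i with
  | zero => simp
  | succ i =>
    rw [Finset.sum_eq_single ⟨i, by omega⟩, Finset.sum_eq_single c]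
    · simp [mul_comm]
    · intro d _ hd
      simp [hd.symm]
    · simp
    · intro j _ hj
      have : i ≠ (j : ℕ) := fun e => hj (Fin.ext e.symm)
      simp [this]
    · simp

lemma IsFanning.mderiv_fundEnd_mul_dmat (hA : IsFanning k n A) {i : ℕ} (hi : i < k) (t : ℝ) :
    mderiv (fundEnd k n A) t * dmat i A t + fundEnd k n A t * dmat (i + 1) A t =
      (i : ℝ) • dmat i A t := by
  have h : (fun s => fundEnd k n A s * dmat i A s) = fun s => (i : ℝ) • dmat (i - 1) A s :=
    funext fun s => hA.fundEnd_mul_dmat hi s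
  have h' := congrFun (congrArg mderiv h) t
  rw [mderiv_mul hA.matSmooth_fundEnd (hA.1.dmat i), mderiv_const_smul, mderiv_dmat,
    mderiv_dmat] at h'
  rw [h']
  cases i <;> simp

lemma IsFanning.mderiv_fundEnd_mul_dmat_of_succ_lt (hA : IsFanning k n A) {i : ℕ}
    (hi : i + 1 < k) (t : ℝ) :
    mderiv (fundEnd k n A) t * dmat i A t = (-1 : ℝ) • dmat i A t := by
  have h := hA.mderiv_fundEnd_mul_dmat (by omega : i < k) t
  rw [hA.fundEnd_mul_dmat hi, Nat.add_sub_cancel] at h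
  rw [eq_sub_of_add_eq h]
  push_cast
  module

lemma IsFanning.mderiv_mderiv_fundEnd_mul_dmat (hA : IsFanning k n A) {i : ℕ}
    (hi : i + 1 < k) (t : ℝ) :
    mderiv (mderiv (fundEnd k n A)) t * dmat i A t =
      -(dmat (i + 1) A t + mderiv (fundEnd k n A) t * dmat (i + 1) A t) := by
  have h : (fun s => mderiv (fundEnd k n A) s * dmat i A s) = fun s => (-1 : ℝ) • dmat i A s :=
    funext fun s => hA.mderiv_fundEnd_mul_dmat_of_succ_lt hi s
  have h' := congrFun (congrArg mderiv h) t
  rw [mderiv_mul hA.matSmooth_fundEnd.mderiv (hA.1.dmat i), mderiv_const_smul, mderiv_dmat] at h'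
  rw [eq_sub_of_add_eq h']
  module

lemma fundProj_eq (hk : k ≠ 0) (A : ℝ → Matrix (Fin (k * n)) (Fin n) ℝ) (t : ℝ) :
    fundProj k n A t =
      (1 : Matrix (Fin (k * n)) (Fin (k * n)) ℝ) -
        (k : ℝ)⁻¹ • (1 + mderiv (fundEnd k n A) t) := by
  have hk' : (k : ℝ) ≠ 0 := Nat.cast_ne_zero.mpr hk
  rw [fundProj, fundRefl]
  match_scalars
  · field_simp
    ring
  · field_simp

lemma mderiv_fundProj (hk : k ≠ 0) (A : ℝ → Matrix (Fin (k * n)) (Fin n) ℝ) (t : ℝ) :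
    mderiv (fundProj k n A) t = -((k : ℝ)⁻¹ • mderiv (mderiv (fundEnd k n A)) t) := by
  rw [funext (fundProj_eq hk A), mderiv_const_sub, mderiv_const_smul]
  congr 2
  ext i j
  simp [mderiv]

lemma horDer_eq_sub_fundEnd_mul (hk : 2 ≤ k) (hA : IsFanning k n A)
    {P : ℕ → ℝ → Matrix (Fin n) (Fin n) ℝ} (hP : IsCoeffs k n A P) (t : ℝ) :
    horDer k n A P t = dmat (k - 1) A t - (k : ℝ)⁻¹ • (fundEnd k n A t * dmat k A t) := by
  have hk' : (k : ℝ) ≠ 0 := by positivity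
  have hterm : ∀ i ∈ Finset.Icc 1 k,
      (k : ℝ)⁻¹ • (fundEnd k n A t * ((k.choose i : ℝ) • (dmat (k - i) A t * P i t))) =
        ((k - 1).choose i : ℝ) • (dmat (k - 1 - i) A t * P i t) := by
    intro i hi
    obtain ⟨h1, h2⟩ := Finset.mem_Icc.mp hi
    have hc : (k.choose i : ℝ) * ((k - i : ℕ) : ℝ) = k * ((k - 1).choose i : ℝ) := by
      obtain ⟨m, rfl⟩ : ∃ m, k = m + 1 := ⟨k - 1, by omega⟩
      exact_mod_cast (Nat.choose_mul_succ_eq m i).symm.trans (mul_comm _ _)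
    rw [Matrix.mul_smul, ← Matrix.mul_assoc, hA.fundEnd_mul_dmat (by omega), Matrix.smul_mul,
      smul_smul, smul_smul, mul_assoc, hc, inv_mul_cancel_left₀ hk', Nat.sub_right_comm]
  have hsum : ∑ i ∈ Finset.Icc 1 k, ((k - 1).choose i : ℝ) • (dmat (k - 1 - i) A t * P i t) =
      ∑ i ∈ Finset.Icc 1 (k - 1), ((k - 1).choose i : ℝ) • (dmat (k - 1 - i) A t * P i t) := by
    refine (Finset.sum_subset (Finset.Icc_subset_Icc_right (by omega)) fun i hi hi' => ?_).symm
    have : k - 1 < i := by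
      simp only [Finset.mem_Icc] at hi hi'
      omega
    simp [Nat.choose_eq_zero_of_lt this]
  rw [eq_neg_of_add_eq_zero_left (hP.2 t), Matrix.mul_neg, smul_neg, sub_neg_eq_add,
    Matrix.mul_sum, Finset.smul_sum, Finset.sum_congr rfl hterm, hsum, horDer]

end Fanning

/-- The four expressions for the horizontal derivative:
`H = (I-P)A^{(k-1)} = P' A^{(k-2)} = A^{(k-1)} - (1/k) F A^{(k)} = -(1/k) F'' A^{(k-2)}`. -/
theorem stmt_8 (k n : ℕ) (hk : 2 ≤ k) (hn : 1 ≤ n)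
    (A : ℝ → Matrix (Fin (k * n)) (Fin n) ℝ) (hA : IsFanning k n A)
    (P : ℕ → ℝ → Matrix (Fin n) (Fin n) ℝ) (hP : IsCoeffs k n A P) (t : ℝ) :
    horDer k n A P t = (1 - fundProj k n A t) * dmat (k - 1) A t ∧
    horDer k n A P t = mderiv (fundProj k n A) t * dmat (k - 2) A t ∧
    horDer k n A P t = dmat (k - 1) A t - (k : ℝ)⁻¹ • (fundEnd k n A t * dmat k A t) ∧
    horDer k n A P t =
      -((k : ℝ)⁻¹ • (mderiv (mderiv (fundEnd k n A)) t * dmat (k - 2) A t)) := by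
  have hk0 : k ≠ 0 := by omega
  have hk' : (k : ℝ) ≠ 0 := Nat.cast_ne_zero.mpr hk0
  have hH := horDer_eq_sub_fundEnd_mul hk hA hP t
  have hF : horDer k n A P t =
      (k : ℝ)⁻¹ • (dmat (k - 1) A t + mderiv (fundEnd k n A) t * dmat (k - 1) A t) := by
    have h := hA.mderiv_fundEnd_mul_dmat (by omega : k - 1 < k) t
    rw [Nat.sub_add_cancel (by omega), Nat.cast_sub (by omega), Nat.cast_one] at h
    rw [hH, eq_sub_of_add_eq h]
    match_scalars
    · field_simp
      ring
    · field_simp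
  have hF2 : horDer k n A P t =
      -((k : ℝ)⁻¹ • (mderiv (mderiv (fundEnd k n A)) t * dmat (k - 2) A t)) := by
    have h := hA.mderiv_mderiv_fundEnd_mul_dmat (by omega : k - 2 + 1 < k) t
    rw [show k - 2 + 1 = k - 1 by omega] at h
    rw [h, hF, smul_neg, neg_neg]
  refine ⟨?_, ?_, hH, hF2⟩
  · rw [hF, fundProj_eq hk0, sub_sub_cancel, Matrix.smul_mul, Matrix.add_mul, Matrix.one_mul]
  · rw [hF2, mderiv_fundProj hk0, Matrix.neg_mul, Matrix.smul_mul]
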